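/- Let P be a permuton and let (X,Y) ~ P. Let (X′,Y′) be an independent copy of (X,Y). Then W₂(id, P)² = 4/3 − 2·E[max{X + Y, X′ + Y′}]. -/

import Mathlib

open MeasureTheory Set Filter
open scoped ENNReal Real Topology

/-- The uniform probability measure on [-1,1]. -/
noncomputable def unif : Measure ℝ := (2 : ℝ≥0∞)⁻¹ • (volume.restrict (Icc (-1 : ℝ) 1))

/-- Optimal transportation cost between two measures for the cost `c`. -/
noncomputable def W2sqCost {K : Type*} [MeasurableSpace K] (c : K × K → ℝ)
    (μ ν : Measure K) : ℝ :=
  sInf {e | ∃ m : Measure (K × K), IsProbabilityMeasure m ∧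
    m.map Prod.fst = μ ∧ m.map Prod.snd = ν ∧ e = ∫ p, c p ∂m}

/-- The squared 2-Wasserstein distance between measures on the plane,
with the Euclidean metric: `W₂(μ,ν)² = inf over couplings of E[‖V-W‖²]`. -/
noncomputable def W2sqE (μ ν : Measure (ℝ × ℝ)) : ℝ :=
  W2sqCost (fun p => (p.1.1 - p.2.1) ^ 2 + (p.1.2 - p.2.2) ^ 2) μ ν

/-- A permuton: a Borel probability measure on the plane whose coordinate marginals
are uniform on [-1,1]. -/
def IsPermuton (μ : Measure (ℝ × ℝ)) : Prop :=
  IsProbabilityMeasure μ ∧ μ.map Prod.fst = unif ∧ μ.map Prod.snd = unif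

/-- The identity permuton, the law of (X, X) with X ~ Uniform[-1,1]. -/
noncomputable def idPermuton : Measure (ℝ × ℝ) := unif.map (fun x => (x, x))

/-- The reverse permuton, the law of (X, -X) with X ~ Uniform[-1,1]. -/
noncomputable def revPermuton : Measure (ℝ × ℝ) := unif.map (fun x => (x, -x))

section Unif

instance isProbabilityMeasure_unif : IsProbabilityMeasure unif := by
  constructor
  rw [unif, Measure.smul_apply, Measure.restrict_apply_univ, Real.volume_Icc, smul_eq_mul]
  norm_num
  exact ENNReal.inv_mul_cancel (by simp) (by simp)

instance nullSingletonClass_unif : NullSingletonClass unif :=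
  ⟨fun x => by simp [unif]⟩

lemma ae_unif_mem_Ioo : ∀ᵐ u ∂unif, u ∈ Ioo (-1 : ℝ) 1 := by
  refine Measure.ae_smul_measure ?_ _
  rw [← restrict_Ioo_eq_restrict_Icc]
  exact ae_restrict_mem measurableSet_Ioo

lemma integral_unif (f : ℝ → ℝ) : ∫ u, f u ∂unif = 2⁻¹ * ∫ u in (-1 : ℝ)..1, f u := by
  rw [unif, integral_smul_measure, intervalIntegral.integral_of_le (by norm_num),
    integral_Icc_eq_integral_Ioc]
  simp

lemma unif_real_Iic {u : ℝ} (h₁ : -1 ≤ u) (h₂ : u ≤ 1) : unif.real (Iic u) = (u + 1) / 2 := by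
  have : Iic u ∩ Icc (-1 : ℝ) 1 = Icc (-1) u := by
    ext x
    simp only [mem_inter_iff, mem_Iic, mem_Icc]
    constructor
    · rintro ⟨a, b, c⟩; exact ⟨b, a⟩
    · rintro ⟨a, b⟩; exact ⟨b, a, b.trans h₂⟩
  rw [measureReal_def, unif, Measure.smul_apply, Measure.restrict_apply measurableSet_Iic, this,
    Real.volume_Icc, smul_eq_mul, ENNReal.toReal_mul, ENNReal.toReal_ofReal (by linarith)]
  simp
  ring

lemma measurable_real_sign : Measurable Real.sign := by
  unfold Real.sign
  exact Measurable.ite measurableSet_Iio measurable_const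
    (Measurable.ite measurableSet_Ioi measurable_const measurable_const)

lemma abs_real_sign_le_one (x : ℝ) : |Real.sign x| ≤ 1 := by
  rcases Real.sign_apply_eq x with h | h | h <;> simp [h]

/-- A point of `[-1, 1]` is the average of the signs of its differences to a uniform variable. -/
lemma integral_unif_sign_sub {u : ℝ} (h₁ : -1 ≤ u) (h₂ : u ≤ 1) :
    ∫ v, Real.sign (u - v) ∂unif = u := by
  have h : (fun v => Real.sign (u - v)) =ᵐ[unif]
      fun v => 2 * (Iic u).indicator (fun _ => (1 : ℝ)) v - 1 := by
    filter_upwards [compl_mem_ae_iff.mpr (measure_singleton (μ := unif) u)] with v hv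
    rcases lt_or_gt_of_ne (show v ≠ u from hv) with h | h
    · rw [Real.sign_of_pos (by linarith), indicator_of_mem (show v ∈ Iic u from h.le)]
      norm_num
    · rw [Real.sign_of_neg (by linarith), indicator_of_notMem (by simpa using h)]
      norm_num
  rw [integral_congr_ae h, integral_sub, integral_const_mul, integral_indicator_const _
    measurableSet_Iic, unif_real_Iic h₁ h₂]
  · simp
    ring
  · exact ((integrable_const _).indicator measurableSet_Iic).const_mul _
  · exact integrable_const _

variable {Ω : Type*} [MeasurableSpace Ω] {m : Measure Ω} {U S : Ω → ℝ}

lemma ae_mem_Ioo_of_map_eq_unif (hU : Measurable U) (hm : m.map U = unif) :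
    ∀ᵐ ω ∂m, U ω ∈ Ioo (-1 : ℝ) 1 := by
  have := ae_unif_mem_Ioo
  rw [← hm] at this
  exact ae_of_ae_map hU.aemeasurable this

lemma integral_eq_zero_of_map_eq_unif (hU : Measurable U) (hm : m.map U = unif) :
    ∫ ω, U ω ∂m = 0 := by
  have := integral_map (μ := m) hU.aemeasurable (f := fun x : ℝ => x) (by fun_prop)
  rw [← this, hm, integral_unif]
  simp

lemma integral_sq_of_map_eq_unif (hU : Measurable U) (hm : m.map U = unif) :
    ∫ ω, U ω ^ 2 ∂m = 1 / 3 := by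
  have := integral_map (μ := m) hU.aemeasurable (f := fun x : ℝ => x ^ 2) (by fun_prop)
  rw [← this, hm, integral_unif]
  simp
  norm_num

lemma memLp_top_of_map_eq_unif (hU : Measurable U) (hm : m.map U = unif) : MemLp U ∞ m := by
  refine memLp_top_of_bound hU.aestronglyMeasurable 1 ?_
  filter_upwards [ae_mem_Ioo_of_map_eq_unif hU hm] with ω hω
  exact abs_le.mpr ⟨hω.1.le, hω.2.le⟩

lemma integral_mul_eq_half_integral_sign [IsProbabilityMeasure m] (hU : Measurable U)
    (hm : m.map U = unif) (hS : Integrable S m) :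
    ∫ ω, U ω * S ω ∂m =
      1 / 2 * ∫ p, Real.sign (U p.1 - U p.2) * (S p.1 - S p.2) ∂(m.prod m) := by
  have hmeas : Measurable fun p : Ω × Ω => Real.sign (U p.1 - U p.2) :=
    measurable_real_sign.comp ((hU.comp measurable_fst).sub (hU.comp measurable_snd))
  have hb : ∀ᵐ p ∂(m.prod m), ‖Real.sign (U p.1 - U p.2)‖ ≤ 1 :=
    ae_of_all _ fun p => abs_real_sign_le_one _
  have i₁ : Integrable (fun p : Ω × Ω => Real.sign (U p.1 - U p.2) * S p.1) (m.prod m) :=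
    (hS.comp_fst m).bdd_mul hmeas.aestronglyMeasurable hb
  have i₂ : Integrable (fun p : Ω × Ω => Real.sign (U p.1 - U p.2) * S p.2) (m.prod m) :=
    (hS.comp_snd m).bdd_mul hmeas.aestronglyMeasurable hb
  have hswap : ∫ p, Real.sign (U p.1 - U p.2) * S p.2 ∂(m.prod m) =
      -∫ p, Real.sign (U p.1 - U p.2) * S p.1 ∂(m.prod m) := by
    rw [← integral_prod_swap, ← integral_neg]
    refine integral_congr_ae (ae_of_all _ fun p => ?_)
    simp only [Prod.fst_swap, Prod.snd_swap]
    rw [← neg_sub, Real.sign_neg, neg_mul]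
  have hfst : ∫ p, Real.sign (U p.1 - U p.2) * S p.1 ∂(m.prod m) = ∫ ω, U ω * S ω ∂m := by
    rw [integral_prod _ i₁]
    refine integral_congr_ae ?_
    filter_upwards [ae_mem_Ioo_of_map_eq_unif hU hm] with ω hω
    have := integral_map (μ := m) hU.aemeasurable (f := fun v => Real.sign (U ω - v))
      (measurable_real_sign.comp (by fun_prop)).aestronglyMeasurable
    rw [integral_mul_const, ← this, hm, integral_unif_sign_sub hω.1.le hω.2.le]
  simp_rw [mul_sub]
  rw [integral_sub i₁ i₂, hswap, hfst]
  ring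

lemma integral_mul_le_half_integral_abs_sub [IsProbabilityMeasure m] (hU : Measurable U)
    (hm : m.map U = unif) (hS : Integrable S m) :
    ∫ ω, U ω * S ω ∂m ≤ 1 / 2 * ∫ p, |S p.1 - S p.2| ∂(m.prod m) := by
  have hmeas : Measurable fun p : Ω × Ω => Real.sign (U p.1 - U p.2) :=
    measurable_real_sign.comp ((hU.comp measurable_fst).sub (hU.comp measurable_snd))
  have hd : Integrable (fun p : Ω × Ω => S p.1 - S p.2) (m.prod m) :=
    (hS.comp_fst m).sub (hS.comp_snd m)
  rw [integral_mul_eq_half_integral_sign hU hm hS]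
  refine mul_le_mul_of_nonneg_left (integral_mono ?_ hd.abs fun p => ?_) (by norm_num)
  · exact hd.bdd_mul hmeas.aestronglyMeasurable
      (ae_of_all _ fun p => (abs_real_sign_le_one _ : _ ≤ (1 : ℝ)))
  · refine (le_abs_self _).trans ?_
    rw [abs_mul]
    exact mul_le_of_le_one_left (abs_nonneg _) (abs_real_sign_le_one _)

lemma integral_mul_eq_half_integral_abs_sub [IsProbabilityMeasure m] {Q : ℝ → ℝ}
    (hU : Measurable U) (hm : m.map U = unif) (hS : Integrable S m)
    (hQ : MonotoneOn Q (Ioo (-1) 1)) (hSQ : ∀ᵐ ω ∂m, S ω = Q (U ω)) :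
    ∫ ω, U ω * S ω ∂m = 1 / 2 * ∫ p, |S p.1 - S p.2| ∂(m.prod m) := by
  rw [integral_mul_eq_half_integral_sign hU hm hS]
  congr 1
  refine integral_congr_ae ?_
  have h := (ae_mem_Ioo_of_map_eq_unif hU hm).and hSQ
  filter_upwards [Measure.quasiMeasurePreserving_fst.ae h,
    Measure.quasiMeasurePreserving_snd.ae h] with p h₁ h₂
  rw [h₁.2, h₂.2]
  rcases lt_trichotomy (U p.1) (U p.2) with h | h | h
  · have := hQ h₁.1 h₂.1 h.le
    rw [Real.sign_of_neg (by linarith), abs_of_nonpos (by linarith)]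
    ring
  · simp [h]
  · have := hQ h₂.1 h₁.1 h.le
    rw [Real.sign_of_pos (by linarith), abs_of_nonneg (by linarith)]
    ring

lemma integral_max_eq_half_integral_abs_sub [IsProbabilityMeasure m] (hS : Integrable S m)
    (h0 : ∫ ω, S ω ∂m = 0) :
    ∫ p, max (S p.1) (S p.2) ∂(m.prod m) = 1 / 2 * ∫ p, |S p.1 - S p.2| ∂(m.prod m) := by
  have i₁ := hS.comp_fst m
  have i₂ := hS.comp_snd m
  have i₁₂ : Integrable (fun p : Ω × Ω => S p.1 + S p.2) (m.prod m) := i₁.add i₂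
  have hd : Integrable (fun p : Ω × Ω => |S p.1 - S p.2|) (m.prod m) := (i₁.sub i₂).abs
  have e₁ : ∫ p, S p.1 ∂(m.prod m) = 0 := by rw [integral_fun_fst]; simp [h0]
  have e₂ : ∫ p, S p.2 ∂(m.prod m) = 0 := by rw [integral_fun_snd]; simp [h0]
  have h : ∀ p : Ω × Ω, max (S p.1) (S p.2) = 1 / 2 * (S p.1 + S p.2 + |S p.1 - S p.2|) := by
    intro p
    rcases le_total (S p.1) (S p.2) with h | h
    · rw [max_eq_right h, abs_of_nonpos (by linarith)]
      ring
    · rw [max_eq_left h, abs_of_nonneg (by linarith)]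
      ring
  simp_rw [h]
  rw [integral_const_mul, integral_add i₁₂ hd, integral_add i₁ i₂, e₁, e₂]
  simp

end Unif

/-- The quantile transform of a probability measure on the line. -/
lemma exists_monotoneOn_map_unif_eq (ν : Measure ℝ) [IsProbabilityMeasure ν] :
    ∃ Q : ℝ → ℝ, Measurable Q ∧ MonotoneOn Q (Ioo (-1) 1) ∧ unif.map Q = ν := by
  classical
  let F := ProbabilityTheory.cdf ν
  let A : ℝ → Set ℝ := fun u => {x | (u + 1) / 2 ≤ F x}
  let Q : ℝ → ℝ := (Ioo (-1 : ℝ) 1).piecewise (fun u => sInf (A u)) 0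
  have hne : ∀ u ∈ Ioo (-1 : ℝ) 1, (A u).Nonempty := fun u hu =>
    ((ProbabilityTheory.tendsto_cdf_atTop ν).eventually_const_le
      (show (u + 1) / 2 < 1 by linarith [hu.2])).exists
  have hbdd : ∀ u ∈ Ioo (-1 : ℝ) 1, BddBelow (A u) := by
    intro u hu
    obtain ⟨b, hb⟩ := ((ProbabilityTheory.tendsto_cdf_atBot ν).eventually_lt_const
      (show 0 < (u + 1) / 2 by linarith [hu.1])).exists
    refine ⟨b, fun x hx => ?_⟩
    by_contra! h
    exact absurd (hx.trans (F.mono h.le)) (not_le.mpr hb)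
  have hgc : ∀ u ∈ Ioo (-1 : ℝ) 1, ∀ x, Q u ≤ x ↔ (u + 1) / 2 ≤ F x := by
    intro u hu x
    rw [show Q u = sInf (A u) from piecewise_eq_of_mem _ _ _ hu]
    refine ⟨fun h => ?_, fun h => csInf_le (hbdd u hu) h⟩
    have hlim : Tendsto F (𝓝[>] x) (𝓝 (F x)) :=
      (F.right_continuous x).mono Ioi_subset_Ici_self
    refine ge_of_tendsto hlim ?_
    filter_upwards [self_mem_nhdsWithin] with y hy
    obtain ⟨z, hz, hzy⟩ := exists_lt_of_csInf_lt (hne u hu) (h.trans_lt hy)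
    exact le_trans hz (F.mono hzy.le)
  have hmeas : Measurable Q := by
    refine measurable_of_Iic fun x => ?_
    have : Q ⁻¹' Iic x = (Ioo (-1 : ℝ) 1).ite {u | (u + 1) / 2 ≤ F x} {_u | 0 ≤ x} := by
      ext u
      by_cases hu : u ∈ Ioo (-1 : ℝ) 1
      · simp only [Set.ite, mem_preimage, mem_Iic, hgc u hu x]
        simp [hu]
      · have : Q u = 0 := piecewise_eq_of_notMem _ _ _ hu
        simp only [Set.ite, mem_preimage, mem_Iic, this, mem_union, mem_inter_iff, Set.mem_sdiff, hu]
        simp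
    rw [this]
    exact measurableSet_Ioo.ite (measurableSet_le (by fun_prop) measurable_const) (by simp)
  refine ⟨Q, hmeas, fun u hu v hv huv => ?_, ?_⟩
  · rw [hgc u hu]
    exact le_trans (by linarith) ((hgc v hv (Q v)).mp le_rfl)
  · have := Measure.isProbabilityMeasure_map (μ := unif) hmeas.aemeasurable
    refine Measure.eq_of_cdf _ _ (StieltjesFunction.ext fun x => ?_)
    rw [ProbabilityTheory.cdf_eq_real, map_measureReal_apply hmeas measurableSet_Iic]
    have h : Q ⁻¹' Iic x =ᵐ[unif] Iic (2 * F x - 1) := by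
      filter_upwards [ae_unif_mem_Ioo] with u hu
      refine propext ((hgc u hu x).trans ?_)
      change _ ↔ u ≤ 2 * F x - 1
      constructor <;> intro h <;> linarith
    rw [measureReal_congr h, unif_real_Iic]
    · simp [F]
    · linarith [ProbabilityTheory.cdf_nonneg ν x]
    · linarith [ProbabilityTheory.cdf_le_one ν x]

open ProbabilityTheory in
/-- Every real random variable has a coupling with a uniform variable of which it is a
monotone function. -/
lemma exists_comonotone_coupling {E : Type*} [MeasurableSpace E] [StandardBorelSpace E]
    [Nonempty E] (μ : Measure E) [IsProbabilityMeasure μ] {S : E → ℝ} (hS : Measurable S) :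
    ∃ (m : Measure (ℝ × E)) (Q : ℝ → ℝ), IsProbabilityMeasure m ∧ m.map Prod.fst = unif ∧
      m.map Prod.snd = μ ∧ MonotoneOn Q (Ioo (-1) 1) ∧ ∀ᵐ p ∂m, S p.2 = Q p.1 := by
  have := Measure.isProbabilityMeasure_map (μ := μ) hS.aemeasurable
  obtain ⟨Q, hQ, hmono, hmap⟩ := exists_monotoneOn_map_unif_eq (μ.map S)
  let κ : Kernel ℝ E := condDistrib id S μ
  let m : Measure (ℝ × E) := unif ⊗ₘ κ.comap Q hQ
  have hF : Measurable (fun p : ℝ × E => (Q p.1, p.2)) := by fun_prop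
  have hm : m.map (fun p : ℝ × E => (Q p.1, p.2)) = μ.map fun z => (S z, z) := by
    have h := compProd_map_condDistrib (μ := μ) (mβ := inferInstance) (X := S) (Y := id)
      measurable_id.aemeasurable
    simp only [id] at h
    rw [← h]
    ext s hs
    rw [Measure.map_apply hF hs, Measure.compProd_apply (hF hs), Measure.compProd_apply hs,
      ← hmap, lintegral_map (Kernel.measurable_kernel_prodMk_left hs) hQ]
    rfl
  refine ⟨m, Q, inferInstance, Measure.fst_compProd _ _, ?_, hmono, ?_⟩
  · have : m.map Prod.snd = (m.map fun p : ℝ × E => (Q p.1, p.2)).map Prod.snd := by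
      rw [Measure.map_map measurable_snd hF]
      rfl
    rw [this, hm, Measure.map_map measurable_snd (by fun_prop)]
    exact Measure.map_id
  · have h : ∀ᵐ q ∂(m.map fun p : ℝ × E => (Q p.1, p.2)), S q.2 = q.1 := by
      rw [hm, ae_map_iff (by fun_prop) (measurableSet_eq_fun (by fun_prop) (by fun_prop))]
      exact ae_of_all _ fun z => rfl
    exact ae_of_ae_map hF.aemeasurable h

lemma integral_sq_sub_add_sq_sub_of_map_eq_unif {Ω : Type*} [MeasurableSpace Ω] {m : Measure Ω}
    [IsProbabilityMeasure m] {U X Y : Ω → ℝ} (hU : Measurable U) (hX : Measurable X)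
    (hY : Measurable Y) (hmU : m.map U = unif) (hmX : m.map X = unif) (hmY : m.map Y = unif) :
    ∫ ω, ((U ω - X ω) ^ 2 + (U ω - Y ω) ^ 2) ∂m =
      4 / 3 - 2 * ∫ ω, U ω * (X ω + Y ω) ∂m := by
  have lU := memLp_top_of_map_eq_unif hU hmU
  have lX := memLp_top_of_map_eq_unif hX hmX
  have lY := memLp_top_of_map_eq_unif hY hmY
  have iU : Integrable (fun ω => U ω ^ 2) m := (lU.mono_exponent le_top).integrable_sq
  have iX : Integrable (fun ω => X ω ^ 2) m := (lX.mono_exponent le_top).integrable_sq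
  have iY : Integrable (fun ω => Y ω ^ 2) m := (lY.mono_exponent le_top).integrable_sq
  have iS : Integrable (fun ω => U ω * (X ω + Y ω)) m :=
    MemLp.integrable_mul (p := 2) (q := 2) (lU.mono_exponent le_top)
      ((lX.add lY).mono_exponent le_top)
  have h : ∀ ω, (U ω - X ω) ^ 2 + (U ω - Y ω) ^ 2 =
      2 * U ω ^ 2 + X ω ^ 2 + Y ω ^ 2 - 2 * (U ω * (X ω + Y ω)) := fun ω => by ring
  simp_rw [h]
  rw [integral_sub (by fun_prop) (iS.const_mul 2), integral_add (by fun_prop) iY,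
    integral_add (iU.const_mul 2) iX,
    integral_const_mul, integral_const_mul, integral_sq_of_map_eq_unif hU hmU,
    integral_sq_of_map_eq_unif hX hmX, integral_sq_of_map_eq_unif hY hmY]
  norm_num

lemma map_fst_idPermuton : idPermuton.map Prod.fst = unif := by
  rw [idPermuton, Measure.map_map measurable_fst (by fun_prop)]
  exact Measure.map_id

lemma ae_idPermuton_fst_eq_snd : ∀ᵐ z ∂idPermuton, z.1 = z.2 := by
  rw [idPermuton, ae_map_iff (by fun_prop) (measurableSet_eq_fun measurable_fst measurable_snd)]
  exact ae_of_all _ fun x => rfl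

/-- for a permuton P ~ (X,Y) with independent copy (X',Y'),
W₂(id,P)² = 4/3 - 2·E[max{X+Y, X'+Y'}]. -/
theorem wasserstein_to_identity_formula
    (μ : Measure (ℝ × ℝ)) [SFinite μ] (h : IsPermuton μ) :
    W2sqE idPermuton μ =
      4 / 3 - 2 * ∫ p, max (p.1.1 + p.1.2) (p.2.1 + p.2.2) ∂(μ.prod μ) := by
  obtain ⟨hprob, h₁, h₂⟩ := h
  let S : ℝ × ℝ → ℝ := fun z => z.1 + z.2
  have hSm : Measurable S := by fun_prop
  have l₁ := (memLp_top_of_map_eq_unif measurable_fst h₁).integrable le_top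
  have l₂ := (memLp_top_of_map_eq_unif measurable_snd h₂).integrable le_top
  have hS : Integrable S μ := l₁.add l₂
  have hS0 : ∫ z, S z ∂μ = 0 := by
    rw [integral_add l₁ l₂, integral_eq_zero_of_map_eq_unif measurable_fst h₁,
      integral_eq_zero_of_map_eq_unif measurable_snd h₂, add_zero]
  have hmax : ∫ p, max (p.1.1 + p.1.2) (p.2.1 + p.2.2) ∂(μ.prod μ) =
      1 / 2 * ∫ p, |S p.1 - S p.2| ∂(μ.prod μ) :=
    integral_max_eq_half_integral_abs_sub hS hS0
  have hpush : ∀ {Ω : Type} [MeasurableSpace Ω] (m : Measure Ω) [IsProbabilityMeasure m]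
      (Z : Ω → ℝ × ℝ), Measurable Z → m.map Z = μ →
      ∫ p, |S (Z p.1) - S (Z p.2)| ∂(m.prod m) = ∫ p, |S p.1 - S p.2| ∂(μ.prod μ) := by
    intro Ω _ m _ Z hZ hmZ
    rw [← hmZ, Measure.map_prod_map _ _ hZ hZ, integral_map (hZ.prodMap hZ).aemeasurable
      (by fun_prop)]
    rfl
  rw [hmax, W2sqE, W2sqCost]
  refine IsLeast.csInf_eq ⟨?_, ?_⟩
  · obtain ⟨m, Q, hm, hmU, hmZ, hQ, hSQ⟩ := exists_comonotone_coupling μ hSm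
    have hG : Measurable fun p : ℝ × ℝ × ℝ => ((p.1, p.1), p.2) := by fun_prop
    refine ⟨m.map fun p => ((p.1, p.1), p.2), Measure.isProbabilityMeasure_map hG.aemeasurable,
      ?_, ?_, ?_⟩
    · rw [Measure.map_map measurable_fst hG, idPermuton, ← hmU,
        Measure.map_map (by fun_prop) measurable_fst]
      rfl
    · rw [Measure.map_map measurable_snd hG]
      exact hmZ
    · have hSZ : Integrable (fun p : ℝ × ℝ × ℝ => S p.2) m :=
        (hmZ ▸ hS : Integrable S (m.map Prod.snd)).comp_measurable measurable_snd
      rw [integral_map hG.aemeasurable (by fun_prop),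
        integral_sq_sub_add_sq_sub_of_map_eq_unif (U := fun p : ℝ × ℝ × ℝ => p.1)
          (X := fun p => p.2.1) (Y := fun p => p.2.2) (by fun_prop) (by fun_prop) (by fun_prop)
          hmU (by rw [← h₁, ← hmZ, Measure.map_map measurable_fst measurable_snd]; rfl)
          (by rw [← h₂, ← hmZ, Measure.map_map measurable_snd measurable_snd]; rfl),
        ← hpush m Prod.snd measurable_snd hmZ,
        ← integral_mul_eq_half_integral_abs_sub measurable_fst hmU hSZ hQ hSQ]
  · rintro e ⟨m, hm, hmV, hmW, rfl⟩
    have hdiag : ∀ᵐ p ∂m, p.1.1 = p.1.2 := by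
      have := ae_idPermuton_fst_eq_snd
      rw [← hmV] at this
      exact ae_of_ae_map measurable_fst.aemeasurable this
    have hmU : m.map (fun p => p.1.1) = unif := by
      rw [← map_fst_idPermuton, ← hmV, Measure.map_map measurable_fst measurable_fst]
      rfl
    have hSW : Integrable (fun p : (ℝ × ℝ) × ℝ × ℝ => S p.2) m :=
      (hmW ▸ hS : Integrable S (m.map Prod.snd)).comp_measurable measurable_snd
    have hcost : ∫ p, ((p.1.1 - p.2.1) ^ 2 + (p.1.2 - p.2.2) ^ 2) ∂m =
        ∫ p, ((p.1.1 - p.2.1) ^ 2 + (p.1.1 - p.2.2) ^ 2) ∂m := by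
      refine integral_congr_ae ?_
      filter_upwards [hdiag] with p hp
      rw [hp]
    rw [hcost, integral_sq_sub_add_sq_sub_of_map_eq_unif (by fun_prop) (by fun_prop)
      (by fun_prop) hmU
      (by rw [← h₁, ← hmW, Measure.map_map measurable_fst measurable_snd]; rfl)
      (by rw [← h₂, ← hmW, Measure.map_map measurable_snd measurable_snd]; rfl),
      ← hpush m Prod.snd measurable_snd hmW]
    have := integral_mul_le_half_integral_abs_sub (by fun_prop) hmU hSW
    linarith
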